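/- arXiv:2111.01835 — 8 statements merged into one kernel-verified Lean document; each statement's English description precedes it below -/
import Mathlib

section
/- (Conway's Circle Theorem.) Let A, B, C be three affinely independent points of the Euclidean plane, with side lengths a = dist B C, b = dist C A, c = dist A B, and let I be the incenter of triangle ABC. Consider the six points obtained by extending each side of the triangle beyond each vertex by the length of the side opposite that vertex: A + (a / c) • (A - B), A + (a / b) • (A - C), B + (b / c) • (B - A), B + (b / a) • (B - C), C + (c / b) • (C - A), C + (c / a) • (C - B). Then these six points are all equidistant from I; in particular they lie on a common circle centered at the incenter I. -/
noncomputable section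

/-- The Euclidean plane. -/
abbrev Pt : Type := EuclideanSpace ℝ (Fin 2)

/-- The radius of the Conway circle of a triangle with side lengths `a`, `b`, `c`. -/
def conwayRadius (a b c : ℝ) : ℝ :=
  √((a ^ 2 * b + a ^ 2 * c + b ^ 2 * a + b ^ 2 * c + c ^ 2 * a + c ^ 2 * b + a * b * c) /
    (a + b + c))

/-- The distance from the incenter of `ABC` to the point obtained by extending the side `BA`
beyond `A` by the length of the side opposite `A`. -/
theorem dist_incenter_extension {V : Type*} [NormedAddCommGroup V] [InnerProductSpace ℝ V]
    {A B C : V} {a b c : ℝ} (ha : a = dist B C) (hb : b = dist C A) (hc : c = dist A B)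
    (ha0 : 0 < a) (hb0 : 0 < b) (hc0 : 0 < c) :
    dist ((a / (a + b + c)) • A + (b / (a + b + c)) • B + (c / (a + b + c)) • C)
      (A + (a / c) • (A - B)) = conwayRadius a b c := by
  have hx : ‖B - A‖ = c := by rw [hc, dist_comm, dist_eq_norm]
  have hy : ‖C - A‖ = b := by rw [hb, dist_eq_norm]
  have hxy : ‖(B - A) - (C - A)‖ = a := by rw [ha, dist_eq_norm, sub_sub_sub_cancel_right]
  have hcos := norm_sub_sq_real (B - A) (C - A)
  rw [hx, hy, hxy] at hcos
  have hinner : inner ℝ (B - A) (C - A) = (b ^ 2 + c ^ 2 - a ^ 2) / 2 := by linarith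
  have hS : a + b + c ≠ 0 := by positivity
  have hvec : (a / (a + b + c)) • A + (b / (a + b + c)) • B + (c / (a + b + c)) • C -
      (A + (a / c) • (A - B)) =
      (b / (a + b + c) + a / c) • (B - A) + (c / (a + b + c)) • (C - A) := by
    have hA : a / (a + b + c) = 1 - b / (a + b + c) - c / (a + b + c) := by
      field_simp
      ring
    rw [hA]
    module
  rw [dist_eq_norm, hvec, conwayRadius, eq_comm, Real.sqrt_eq_iff_eq_sq (by positivity)
    (norm_nonneg _), norm_add_sq_real, norm_smul, norm_smul, inner_smul_left, inner_smul_right,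
    hinner, hx, hy, mul_pow, mul_pow, Real.norm_eq_abs, Real.norm_eq_abs, sq_abs, sq_abs,
    conj_trivial]
  field_simp
  ring

/-- The Conway radius is invariant under swapping its first two arguments. -/
theorem conwayRadius_swap_left (a b c : ℝ) : conwayRadius b a c = conwayRadius a b c := by
  unfold conwayRadius
  ring_nf

/-- The Conway radius is invariant under swapping its last two arguments. -/
theorem conwayRadius_swap_right (a b c : ℝ) : conwayRadius a c b = conwayRadius a b c := by
  unfold conwayRadius
  ring_nf

/-- **Conway's Circle Theorem.**  For a triangle `ABC` with side lengths
`a = dist B C`, `b = dist C A`, `c = dist A B` and incenter `I`, the six points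
obtained by extending each side beyond each vertex by the length of the side
opposite that vertex are all equidistant from `I`. -/
theorem conway_circle
    (A B C I : Pt)
    (hABC : AffineIndependent ℝ ![A, B, C])
    (a b c : ℝ)
    (ha : a = dist B C) (hb : b = dist C A) (hc : c = dist A B)
    (hI : I = (a / (a + b + c)) • A + (b / (a + b + c)) • B + (c / (a + b + c)) • C) :
    ∃ ρ : ℝ,
      dist I (A + (a / c) • (A - B)) = ρ ∧
      dist I (A + (a / b) • (A - C)) = ρ ∧
      dist I (B + (b / c) • (B - A)) = ρ ∧
      dist I (B + (b / a) • (B - C)) = ρ ∧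
      dist I (C + (c / b) • (C - A)) = ρ ∧
      dist I (C + (c / a) • (C - B)) = ρ := by
  have hBC : B ≠ C := hABC.injective.ne (by decide : (1 : Fin 3) ≠ 2)
  have hCA : C ≠ A := hABC.injective.ne (by decide : (2 : Fin 3) ≠ 0)
  have hAB : A ≠ B := hABC.injective.ne (by decide : (0 : Fin 3) ≠ 1)
  have ha0 : 0 < a := ha ▸ dist_pos.mpr hBC
  have hb0 : 0 < b := hb ▸ dist_pos.mpr hCA
  have hc0 : 0 < c := hc ▸ dist_pos.mpr hAB
  have ha' := ha.trans (dist_comm B C)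
  have hb' := hb.trans (dist_comm C A)
  have hc' := hc.trans (dist_comm A B)
  subst hI
  refine ⟨conwayRadius a b c, dist_incenter_extension ha hb hc ha0 hb0 hc0, ?_, ?_, ?_, ?_, ?_⟩
  · rw [← conwayRadius_swap_right, ← dist_incenter_extension ha' hc' hb' ha0 hc0 hb0,
      add_right_comm a c b, add_right_comm (_ • A)]
  · rw [← conwayRadius_swap_left, ← dist_incenter_extension hb' ha' hc' hb0 ha0 hc0,
      add_comm b a, add_comm (_ • B) (_ • A)]
  · rw [← conwayRadius_swap_left, ← conwayRadius_swap_right,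
      ← dist_incenter_extension hb hc ha hb0 hc0 ha0,
      show b + c + a = a + b + c by ring, add_rotate (_ • B), add_rotate (_ • C)]
  · rw [← conwayRadius_swap_right, ← conwayRadius_swap_left,
      ← dist_incenter_extension hc ha hb hc0 ha0 hb0,
      show c + a + b = a + b + c by ring, add_rotate (_ • C)]
  · rw [← conwayRadius_swap_left, ← conwayRadius_swap_right, ← conwayRadius_swap_left,
      ← dist_incenter_extension hc' hb' ha' hc0 hb0 ha0,
      show c + b + a = a + b + c by ring]
    congr 1
    abel
end
end

section
/- (Theorem 1, sufficiency.) Let A, B, C be affinely independent points of the Euclidean plane with opposite side lengths λ_A = dist B C, λ_B = dist C A, λ_C = dist A B, and let I be the incenter. Let x_A, x_B, x_C be real numbers satisfying x_A - x_B = λ_A - λ_B and x_B - x_C = λ_B - λ_C. Form the six points obtained by extending both sides through A beyond A by signed length x_A (namely A + (x_A / λ_C) • (A - B) and A + (x_A / λ_B) • (A - C)), both sides through B beyond B by x_B, and both sides through C beyond C by x_C. Then these six points are all equidistant from I, i.e., they lie on a common circle centered at the incenter I. -/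
noncomputable section

/-- In a triangle with side lengths `a`, `b`, `c`, extending the side `BA` beyond `A` by the signed
length `a + t` gives a point whose distance from the incenter `I` is symmetric in `a`, `b`, `c`. -/
theorem dist_incenter_side_extension {V : Type*} [NormedAddCommGroup V] [InnerProductSpace ℝ V]
    {A B C : V} {a b c : ℝ} (ha : a = dist B C) (hb : b = dist C A) (hc : c = dist A B)
    (hAB : A ≠ B) {s q p : ℝ} (hs : s = a + b + c) (hq : q = a * b + b * c + c * a)
    (hp : p = a * b * c) {I : V} (hI : I = (a / s) • A + (b / s) • B + (c / s) • C) (t : ℝ) :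
    dist I (A + ((a + t) / c) • (A - B)) = √(q - 2 * p / s + t ^ 2 + t * s) := by
  have hc0 : 0 < c := hc ▸ dist_pos.2 hAB
  have hs0 : 0 < s := by
    have ha0 : 0 ≤ a := ha ▸ dist_nonneg
    have hb0 : 0 ≤ b := hb ▸ dist_nonneg
    rw [hs]
    positivity
  have hu : ‖B - A‖ = c := by rw [hc, dist_eq_norm, norm_sub_rev]
  have hv : ‖C - A‖ = b := by rw [hb, dist_eq_norm]
  have huv : a ^ 2 = c ^ 2 - 2 * inner ℝ (B - A) (C - A) + b ^ 2 := by
    rw [ha, dist_eq_norm, ← hu, ← hv, ← norm_sub_sq_real, sub_sub_sub_cancel_right]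
  have hsub : I - (A + ((a + t) / c) • (A - B)) =
      (b / s + (a + t) / c) • (B - A) + (c / s) • (C - A) := by
    have hsum : a / s = 1 - b / s - c / s := by
      field_simp
      linarith
    rw [hI, hsum]
    module
  have hinner : inner ℝ (B - A) (C - A) = (b ^ 2 + c ^ 2 - a ^ 2) / 2 := by linarith
  rw [dist_eq_norm, hsub, ← Real.sqrt_sq (norm_nonneg _), norm_add_sq_real, norm_smul, norm_smul,
    inner_smul_left, inner_smul_right, hu, hv, hinner, mul_pow, mul_pow, Real.norm_eq_abs,
    Real.norm_eq_abs, sq_abs, sq_abs]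
  congr 1
  simp only [conj_trivial]
  rw [hq, hp]
  field_simp
  rw [hs]
  ring

/-- **Theorem 1 (sufficiency).**  If the side extensions `x_A, x_B, x_C` at the
vertices of a triangle satisfy `x_U - x_V = λ_U - λ_V` for all vertices, then
the six endpoints of the extensions are equidistant from the incenter `I`. -/
theorem conway_circles_triangle_sufficiency
    (A B C I : Pt)
    (hABC : AffineIndependent ℝ ![A, B, C])
    (lA lB lC : ℝ)
    (hlA : lA = dist B C) (hlB : lB = dist C A) (hlC : lC = dist A B)
    (hI : I = (lA / (lA + lB + lC)) • A + (lB / (lA + lB + lC)) • B +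
      (lC / (lA + lB + lC)) • C)
    (xA xB xC : ℝ)
    (hAB : xA - xB = lA - lB) (hBC : xB - xC = lB - lC) :
    ∃ ρ : ℝ,
      dist I (A + (xA / lC) • (A - B)) = ρ ∧
      dist I (A + (xA / lB) • (A - C)) = ρ ∧
      dist I (B + (xB / lC) • (B - A)) = ρ ∧
      dist I (B + (xB / lA) • (B - C)) = ρ ∧
      dist I (C + (xC / lB) • (C - A)) = ρ ∧
      dist I (C + (xC / lA) • (C - B)) = ρ := by
  have hinj := hABC.injective
  have hneAB : A ≠ B := hinj.ne (show (0 : Fin 3) ≠ 1 by decide)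
  have hneAC : A ≠ C := hinj.ne (show (0 : Fin 3) ≠ 2 by decide)
  have hneBC : B ≠ C := hinj.ne (show (1 : Fin 3) ≠ 2 by decide)
  have hlA' : lA = dist C B := by rw [hlA, dist_comm]
  have hlB' : lB = dist A C := by rw [hlB, dist_comm]
  have hlC' : lC = dist B A := by rw [hlC, dist_comm]
  obtain ⟨t, rfl⟩ : ∃ t, xA = lA + t := ⟨xA - lA, by ring⟩
  obtain rfl : xB = lB + t := by linarith
  obtain rfl : xC = lC + t := by linarith
  refine ⟨_, dist_incenter_side_extension hlA hlB hlC hneAB rfl rfl rfl hI t, ?_, ?_, ?_, ?_, ?_⟩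
  · exact dist_incenter_side_extension hlA' hlC' hlB' hneAC (by ring) (by ring) (by ring)
      (by rw [hI]; abel) t
  · exact dist_incenter_side_extension hlB' hlA' hlC' hneAB.symm (by ring) (by ring) (by ring)
      (by rw [hI]; abel) t
  · exact dist_incenter_side_extension hlB hlC hlA hneBC (by ring) (by ring) (by ring)
      (by rw [hI]; abel) t
  · exact dist_incenter_side_extension hlC hlA hlB hneAC.symm (by ring) (by ring) (by ring)
      (by rw [hI]; abel) t
  · exact dist_incenter_side_extension hlC' hlB' hlA' hneBC.symm (by ring) (by ring) (by ring)
      (by rw [hI]; abel) t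
end
end

section
/- (Theorem 1, necessity.) Let A, B, C be affinely independent points of the Euclidean plane with opposite side lengths λ_A = dist B C, λ_B = dist C A, λ_C = dist A B, and let I be the incenter. Let x_A, x_B, x_C be nonnegative real numbers, and form the six points obtained by extending both sides through A beyond A by length x_A (namely A + (x_A / λ_C) • (A - B) and A + (x_A / λ_B) • (A - C)), both sides through B beyond B by x_B, and both sides through C beyond C by x_C. If these six points are all equidistant from I (i.e., lie on a common circle centered at the incenter), then x_A - x_B = λ_A - λ_B and x_B - x_C = λ_B - λ_C. -/
noncomputable section

open RealInnerProductSpace in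
/-- The squared distance from the incenter of a triangle `P Q R` with side lengths `p, q, r` to the
endpoint of the extension of `QP` beyond `P` by `x`. -/
lemma dist_incenter_extension_sq {V : Type*} [NormedAddCommGroup V] [InnerProductSpace ℝ V]
    {P Q R I : V} {p q r : ℝ} (hp : p = dist Q R) (hq : q = dist R P) (hr : r = dist P Q)
    (hPQ : P ≠ Q)
    (hI : I = (p / (p + q + r)) • P + (q / (p + q + r)) • Q + (r / (p + q + r)) • R) (x : ℝ) :
    dist I (P + (x / r) • (P - Q)) ^ 2 =
      q * r * (q + r - p) / (p + q + r) + x * (q + r - p) + x ^ 2 := by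
  have hr0 : 0 < r := hr ▸ dist_pos.2 hPQ
  have hs : 0 < p + q + r := by
    have : 0 ≤ p := hp ▸ dist_nonneg
    have : 0 ≤ q := hq ▸ dist_nonneg
    positivity
  obtain ⟨u, rfl⟩ : ∃ u, Q = P + u := ⟨Q - P, by abel⟩
  obtain ⟨v, rfl⟩ : ∃ v, R = P + v := ⟨R - P, by abel⟩
  have hu : ⟪u, u⟫ = r ^ 2 := by simp [hr]
  have hv : ⟪v, v⟫ = q ^ 2 := by simp [hq]
  have huv : ⟪u, v⟫ = (q ^ 2 + r ^ 2 - p ^ 2) / 2 := by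
    have hp2 : p ^ 2 = ‖u - v‖ ^ 2 := by rw [hp, dist_add_left, dist_eq_norm]
    rw [norm_sub_sq_real, ← real_inner_self_eq_norm_sq, ← real_inner_self_eq_norm_sq, hu, hv] at hp2
    linarith
  have hsub : I - (P + (x / r) • (P - (P + u))) =
      (q / (p + q + r) + x / r) • u + (r / (p + q + r)) • v := by
    rw [hI]
    match_scalars <;> field_simp <;> ring
  rw [dist_eq_norm, hsub, ← real_inner_self_eq_norm_sq]
  simp only [inner_add_left, inner_add_right, real_inner_smul_left, real_inner_smul_right,
    real_inner_comm u v, hu, hv, huv]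
  field_simp
  ring

/-- If the extensions by `x` and `y` along a side of length `c` end at equal distances from the
incenter, then `x - y` is the difference of the opposite side lengths. -/
lemma extension_sub_eq_of_incenter_sq_eq {a b c x y : ℝ} (ha : 0 < a) (hb : 0 < b) (hc : 0 < c)
    (hx : 0 ≤ x) (hy : 0 ≤ y)
    (h : b * c * (b + c - a) / (a + b + c) + x * (b + c - a) + x ^ 2 =
      c * a * (c + a - b) / (a + b + c) + y * (c + a - b) + y ^ 2) :
    x - y = a - b := by
  have hs : a + b + c ≠ 0 := by positivity
  have hdiff : b * c * (b + c - a) / (a + b + c) - c * a * (c + a - b) / (a + b + c) =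
      c * (b - a) := by
    field_simp
    ring
  have hprod : (x - y - (a - b)) * (x + y + c) = 0 := by linear_combination h - hdiff
  have hpos : x + y + c ≠ 0 := by positivity
  exact sub_eq_zero.1 ((mul_eq_zero.1 hprod).resolve_right hpos)

/-- **Theorem 1 (necessity).**  If the six endpoints of nonnegative side
extensions `x_A, x_B, x_C` at the vertices of a triangle are equidistant from
the incenter `I`, then `x_U - x_V = λ_U - λ_V` for all vertices. -/
theorem conway_circles_triangle_necessity
    (A B C I : Pt)
    (hABC : AffineIndependent ℝ ![A, B, C])
    (lA lB lC : ℝ)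
    (hlA : lA = dist B C) (hlB : lB = dist C A) (hlC : lC = dist A B)
    (hI : I = (lA / (lA + lB + lC)) • A + (lB / (lA + lB + lC)) • B +
      (lC / (lA + lB + lC)) • C)
    (xA xB xC : ℝ)
    (hxA : 0 ≤ xA) (hxB : 0 ≤ xB) (hxC : 0 ≤ xC)
    (hconcyclic : ∃ ρ : ℝ,
      dist I (A + (xA / lC) • (A - B)) = ρ ∧
      dist I (A + (xA / lB) • (A - C)) = ρ ∧
      dist I (B + (xB / lC) • (B - A)) = ρ ∧
      dist I (B + (xB / lA) • (B - C)) = ρ ∧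
      dist I (C + (xC / lB) • (C - A)) = ρ ∧
      dist I (C + (xC / lA) • (C - B)) = ρ) :
    xA - xB = lA - lB ∧ xB - xC = lB - lC := by
  obtain ⟨ρ, hAB, -, hBA, hBC, -, hCB⟩ := hconcyclic
  have hne : A ≠ B ∧ B ≠ C ∧ C ≠ A :=
    ⟨hABC.injective.ne (show (0 : Fin 3) ≠ 1 by decide),
      hABC.injective.ne (show (1 : Fin 3) ≠ 2 by decide),
      hABC.injective.ne (show (2 : Fin 3) ≠ 0 by decide)⟩
  obtain ⟨hne_AB, hne_BC, hne_CA⟩ := hne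
  have ha : 0 < lA := hlA ▸ dist_pos.2 hne_BC
  have hb : 0 < lB := hlB ▸ dist_pos.2 hne_CA
  have hc : 0 < lC := hlC ▸ dist_pos.2 hne_AB
  have eAB := dist_incenter_extension_sq hlA hlB hlC hne_AB hI xA
  have eBA := dist_incenter_extension_sq (P := B) (Q := A) (R := C) (I := I) (p := lB) (q := lA)
    (r := lC) (by rw [hlB, dist_comm]) (by rw [hlA, dist_comm]) (by rw [hlC, dist_comm])
    hne_AB.symm (by rw [hI, add_comm lB lA]; abel) xB
  have eBC := dist_incenter_extension_sq (P := B) (Q := C) (R := A) (I := I) (p := lB) (q := lC)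
    (r := lA) hlB hlC hlA hne_BC
    (by rw [hI, show lB + lC + lA = lA + lB + lC by ring]; abel) xB
  have eCB := dist_incenter_extension_sq (P := C) (Q := B) (R := A) (I := I) (p := lC) (q := lB)
    (r := lA) (by rw [hlC, dist_comm]) (by rw [hlB, dist_comm]) (by rw [hlA, dist_comm])
    hne_BC.symm (by rw [hI, show lC + lB + lA = lA + lB + lC by ring]; abel) xC
  rw [hAB] at eAB
  rw [hBA] at eBA
  rw [hBC] at eBC
  rw [hCB] at eCB
  constructor
  · refine extension_sub_eq_of_incenter_sq_eq ha hb hc hxA hxB ?_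
    rw [← eAB, eBA]
    ring
  · refine extension_sub_eq_of_incenter_sq_eq hb hc ha hxB hxC ?_
    rw [← eBC, eCB]
    ring
end
end

section
/- (Corollary 1: Conway circles at a triangle vertex.) Let A, B, C be affinely independent points of the Euclidean plane with opposite side lengths λ_A = dist B C, λ_B = dist C A, λ_C = dist A B, and let I be the incenter. Form the four points obtained by extending both sides through B beyond B by signed length λ_B - λ_A (namely B + ((λ_B - λ_A) / λ_C) • (B - A) and B + ((λ_B - λ_A) / λ_A) • (B - C)) and both sides through C beyond C by signed length λ_C - λ_A. Then each of these four points is at distance dist I A from I; in particular, the four points together with A lie on a common circle centered at the incenter I and passing through A. -/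
noncomputable section

/-- The squared distance from the incenter of `A B C` to the point obtained by extending the side
`AB` beyond `B` by the signed length `x`. -/
theorem dist_incenter_extend_sq {V : Type*} [NormedAddCommGroup V] [InnerProductSpace ℝ V]
    {A B C I : V} {a b c : ℝ} (ha : a = dist B C) (hb : b = dist C A) (hc : c = dist A B)
    (hc0 : c ≠ 0) (hs : a + b + c ≠ 0)
    (hI : I = (a / (a + b + c)) • A + (b / (a + b + c)) • B + (c / (a + b + c)) • C) (x : ℝ) :
    dist I (B + (x / c) • (B - A)) ^ 2 =
      a * c * (a + c - b) / (a + b + c) + x ^ 2 + x * (a + c - b) := by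
  obtain ⟨u, rfl⟩ : ∃ u, A = B + u := ⟨A - B, by abel⟩
  obtain ⟨v, rfl⟩ : ∃ v, C = B + v := ⟨C - B, by abel⟩
  have hu : inner ℝ u u = c ^ 2 := by
    rw [real_inner_self_eq_norm_sq, hc, dist_self_add_left]
  have hv : inner ℝ v v = a ^ 2 := by
    rw [real_inner_self_eq_norm_sq, ha, dist_self_add_right]
  have huv : inner ℝ u v = (a ^ 2 + c ^ 2 - b ^ 2) / 2 := by
    have h : b ^ 2 = inner ℝ (v - u) (v - u) := by
      rw [real_inner_self_eq_norm_sq, hb, dist_add_left, dist_eq_norm]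
    rw [real_inner_sub_sub_self, hu, hv, real_inner_comm] at h
    linarith
  have hw : I - (B + (x / c) • (B - (B + u))) =
      (a / (a + b + c) + x / c) • u + (c / (a + b + c)) • v := by
    have h1 : b / (a + b + c) = 1 - a / (a + b + c) - c / (a + b + c) := by
      field_simp
      ring
    rw [hI, h1]
    module
  rw [dist_eq_norm, hw, ← real_inner_self_eq_norm_sq, real_inner_add_add_self]
  simp only [real_inner_smul_left, real_inner_smul_right, hu, hv, huv]
  field_simp
  ring

/-- **Corollary 1 (Conway circles at a triangle vertex).**  Extending the sides
through `B` by `λ_B - λ_A` and the sides through `C` by `λ_C - λ_A` yields four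
points which, together with `A`, lie on a circle centered at the incenter. -/
theorem conway_circles_at_vertex
    (A B C I : Pt)
    (hABC : AffineIndependent ℝ ![A, B, C])
    (lA lB lC : ℝ)
    (hlA : lA = dist B C) (hlB : lB = dist C A) (hlC : lC = dist A B)
    (hI : I = (lA / (lA + lB + lC)) • A + (lB / (lA + lB + lC)) • B +
      (lC / (lA + lB + lC)) • C) :
    dist I (B + ((lB - lA) / lC) • (B - A)) = dist I A ∧
    dist I (B + ((lB - lA) / lA) • (B - C)) = dist I A ∧
    dist I (C + ((lC - lA) / lB) • (C - A)) = dist I A ∧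
    dist I (C + ((lC - lA) / lA) • (C - B)) = dist I A := by
  have hAB : A ≠ B := fun h => by simpa using hABC.injective.ne (show (0 : Fin 3) ≠ 1 by decide) h
  have hBC : B ≠ C := fun h => by simpa using hABC.injective.ne (show (1 : Fin 3) ≠ 2 by decide) h
  have hCA : C ≠ A := fun h => by simpa using hABC.injective.ne (show (2 : Fin 3) ≠ 0 by decide) h
  have ha : 0 < lA := hlA ▸ dist_pos.2 hBC
  have hb : 0 < lB := hlB ▸ dist_pos.2 hCA
  have hc : 0 < lC := hlC ▸ dist_pos.2 hAB
  have hlA' := hlA.trans (dist_comm B C)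
  have hlB' := hlB.trans (dist_comm C A)
  have hlC' := hlC.trans (dist_comm A B)
  have hsum : lA + lB + lC ≠ 0 := by positivity
  have hIA : dist I A ^ 2 = lB * lC * (lB + lC - lA) / (lA + lB + lC) := by
    have h := dist_incenter_extend_sq (I := I) hlB' hlA' hlC' hc.ne' (by positivity)
      (by rw [hI, show lB + lA + lC = lA + lB + lC by ring]; abel) 0
    simp only [zero_div, zero_smul, add_zero] at h
    rw [h]
    field_simp
    ring
  refine ⟨?_, ?_, ?_, ?_⟩ <;> rw [← sq_eq_sq₀ dist_nonneg dist_nonneg, hIA]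
  · rw [dist_incenter_extend_sq (I := I) hlA hlB hlC hc.ne' hsum hI]
    field_simp
    ring
  · rw [dist_incenter_extend_sq (I := I) hlC' hlB' hlA' ha.ne' (by positivity)
      (by rw [hI, show lC + lB + lA = lA + lB + lC by ring]; abel)]
    field_simp
    ring
  · rw [dist_incenter_extend_sq (I := I) hlA' hlC' hlB' hb.ne' (by positivity)
      (by rw [hI, show lA + lC + lB = lA + lB + lC by ring]; abel)]
    field_simp
    ring
  · rw [dist_incenter_extend_sq (I := I) hlB hlC hlA ha.ne' (by positivity)
      (by rw [hI, show lB + lC + lA = lA + lB + lC by ring]; abel)]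
    field_simp
    ring
end
end

section
/- (Incircle specialization of Theorem 1.) Let A, B, C be affinely independent points of the Euclidean plane with opposite side lengths λ_A = dist B C, λ_B = dist C A, λ_C = dist A B, and let I be the incenter. Set x_A = (λ_A - λ_B - λ_C)/2, x_B = (λ_B - λ_A - λ_C)/2, x_C = (λ_C - λ_A - λ_B)/2, and form the six points obtained by extending both sides through A beyond A by signed length x_A (namely A + (x_A / λ_C) • (A - B) and A + (x_A / λ_B) • (A - C)), both sides through B beyond B by x_B, and both sides through C beyond C by x_C. Then each of the six points has distance from I equal to the distance from I to the line through B and C (the inradius); i.e., the resulting circle is the incircle of the triangle. -/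
noncomputable section

/-- The squared norm of a combination of two sides of a triangle, in terms of the side lengths. -/
theorem norm_smul_sub_add_smul_sub_sq {V : Type*} [NormedAddCommGroup V] [InnerProductSpace ℝ V]
    (A B C : V) (u v : ℝ) :
    ‖u • (B - A) + v • (C - A)‖ ^ 2 =
      u ^ 2 * dist A B ^ 2 + v ^ 2 * dist C A ^ 2 +
        u * v * (dist A B ^ 2 + dist C A ^ 2 - dist B C ^ 2) := by
  have h := norm_sub_sq_real (B - A) (C - A)
  rw [sub_sub_sub_cancel_right] at h
  rw [norm_add_sq_real, norm_smul, norm_smul, real_inner_smul_left, real_inner_smul_right,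
    mul_pow, mul_pow, Real.norm_eq_abs, Real.norm_eq_abs, sq_abs, sq_abs, dist_comm A B,
    dist_eq_norm, dist_eq_norm, dist_eq_norm]
  linear_combination u * v * h

/-- If `B + t₀ • (C - B)` is a point of the line through `B` and `C` at minimal distance from `P`, then
that distance is the distance from `P` to the line. -/
theorem infDist_affineSpan_pair_eq {V : Type*} [NormedAddCommGroup V] [NormedSpace ℝ V]
    {P B C : V} (t₀ : ℝ)
    (h : ∀ t : ℝ, dist P (B + t₀ • (C - B)) ≤ dist P (B + t • (C - B))) :
    Metric.infDist P (affineSpan ℝ {B, C} : Set V) = dist P (B + t₀ • (C - B)) := by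
  have hline (t : ℝ) : AffineMap.lineMap B C t = B + t • (C - B) := by
    rw [AffineMap.lineMap_apply_module', add_comm]
  apply le_antisymm
  · apply Metric.infDist_le_dist_of_mem
    rw [← hline]
    exact AffineMap.lineMap_mem_affineSpan_pair t₀ B C
  · rw [Metric.le_infDist ⟨B, left_mem_affineSpan_pair ℝ B C⟩]
    intro y hy
    obtain ⟨t, rfl⟩ := mem_affineSpan_pair_iff_exists_lineMap_eq.mp hy
    rw [hline]
    exact h t

/-- **Incircle specialization of Theorem 1.**  With `x_A = (λ_A - λ_B - λ_C)/2`
etc., the six extension endpoints all lie at distance from the incenter `I`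
equal to the distance from `I` to the line `BC`, i.e. on the incircle. -/
theorem conway_circle_incircle_case
    (A B C I : Pt)
    (hABC : AffineIndependent ℝ ![A, B, C])
    (lA lB lC : ℝ)
    (hlA : lA = dist B C) (hlB : lB = dist C A) (hlC : lC = dist A B)
    (hI : I = (lA / (lA + lB + lC)) • A + (lB / (lA + lB + lC)) • B +
      (lC / (lA + lB + lC)) • C)
    (xA xB xC : ℝ)
    (hxA : xA = (lA - lB - lC) / 2) (hxB : xB = (lB - lA - lC) / 2)
    (hxC : xC = (lC - lA - lB) / 2) :
    dist I (A + (xA / lC) • (A - B)) = Metric.infDist I (affineSpan ℝ {B, C} : Set Pt) ∧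
    dist I (A + (xA / lB) • (A - C)) = Metric.infDist I (affineSpan ℝ {B, C} : Set Pt) ∧
    dist I (B + (xB / lC) • (B - A)) = Metric.infDist I (affineSpan ℝ {B, C} : Set Pt) ∧
    dist I (B + (xB / lA) • (B - C)) = Metric.infDist I (affineSpan ℝ {B, C} : Set Pt) ∧
    dist I (C + (xC / lB) • (C - A)) = Metric.infDist I (affineSpan ℝ {B, C} : Set Pt) ∧
    dist I (C + (xC / lA) • (C - B)) = Metric.infDist I (affineSpan ℝ {B, C} : Set Pt) := by
  have ha : 0 < lA := hlA ▸ dist_pos.mpr (hABC.injective.ne (show (1 : Fin 3) ≠ 2 by decide))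
  have hb : 0 < lB := hlB ▸ dist_pos.mpr (hABC.injective.ne (show (2 : Fin 3) ≠ 0 by decide))
  have hc : 0 < lC := hlC ▸ dist_pos.mpr (hABC.injective.ne (show (0 : Fin 3) ≠ 1 by decide))
  have hs : lA + lB + lC ≠ 0 := by positivity
  have hI' : I = A + (lB / (lA + lB + lC)) • (B - A) + (lC / (lA + lB + lC)) • (C - A) := by
    have h : lA / (lA + lB + lC) = 1 - lB / (lA + lB + lC) - lC / (lA + lB + lC) := by
      field_simp
      ring
    rw [hI, h]
    module
  have hdist (T : Pt) (u v : ℝ) (hT : T = A + u • (B - A) + v • (C - A)) :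
      dist I T ^ 2 = (lB / (lA + lB + lC) - u) ^ 2 * lC ^ 2 +
        (lC / (lA + lB + lC) - v) ^ 2 * lB ^ 2 +
        (lB / (lA + lB + lC) - u) * (lC / (lA + lB + lC) - v) *
          (lC ^ 2 + lB ^ 2 - lA ^ 2) := by
    rw [hlA, hlB, hlC, ← norm_smul_sub_add_smul_sub_sq, ← hlA, ← hlB, ← hlC, dist_eq_norm, hT, hI']
    congr 2
    module
  have hBC (t : ℝ) : dist I (B + t • (C - B)) ^ 2 =
      -2 * xA * xB * xC / (lA + lB + lC) + (t * lA + xB) ^ 2 := by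
    rw [hdist _ (1 - t) t (by module), hxA, hxB, hxC]
    field_simp
    ring
  have hinf : Metric.infDist I (affineSpan ℝ {B, C} : Set Pt) ^ 2 =
      -2 * xA * xB * xC / (lA + lB + lC) := by
    have h₀ : -xB / lA * lA + xB = 0 := by
      field_simp
      ring
    rw [infDist_affineSpan_pair_eq (-xB / lA), hBC, h₀]
    · ring
    · intro t
      rw [← sq_le_sq₀ dist_nonneg dist_nonneg, hBC, hBC, h₀]
      nlinarith [sq_nonneg (t * lA + xB)]
  have key (T : Pt) (u v : ℝ) (hT : T = A + u • (B - A) + v • (C - A))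
      (h : (lB / (lA + lB + lC) - u) ^ 2 * lC ^ 2 +
        (lC / (lA + lB + lC) - v) ^ 2 * lB ^ 2 +
        (lB / (lA + lB + lC) - u) * (lC / (lA + lB + lC) - v) *
          (lC ^ 2 + lB ^ 2 - lA ^ 2) = -2 * xA * xB * xC / (lA + lB + lC)) :
      dist I T = Metric.infDist I (affineSpan ℝ {B, C} : Set Pt) := by
    rw [← sq_eq_sq₀ dist_nonneg Metric.infDist_nonneg, hinf, hdist T u v hT, h]
  refine ⟨key _ (-xA / lC) 0 (by module) ?_, key _ 0 (-xA / lB) (by module) ?_,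
    key _ (1 + xB / lC) 0 (by module) ?_, key _ (1 + xB / lA) (-xB / lA) (by module) ?_,
    key _ 0 (1 + xC / lB) (by module) ?_, key _ (-xC / lA) (1 + xC / lA) (by module) ?_⟩ <;>
  · rw [hxA, hxB, hxC]
    field_simp
    ring
end
end

section
/- (Theorem 2, sufficiency: Conway circles for odd tangential polygons.) Let n ≥ 3 be odd and let V : ZMod n → ℝ² be the vertices of a convex tangential polygon with incenter I, inradius r > 0, and side lengths λ i = dist (V i) (V (i+1)). Let x : ZMod n → ℝ satisfy x i - x (i+2) = λ (i+1) - λ i for every i. For each i form the two points obtained by extending both sides through V i beyond V i by signed length x i: the point V i + (x i / λ i) • (V i - V (i+1)) and the point V i + (x i / λ (i-1)) • (V i - V (i-1)). Then all 2n resulting points are equidistant from I, i.e., they lie on a common circle centered at I. -/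
noncomputable section

/-- If `T` realises the distance from `I` to the line `VW`, then `T` is the foot of the
perpendicular from `I`. -/
lemma inner_sub_eq_zero_of_dist_eq_infDist {I T V W : Pt} (hT : T ∈ affineSpan ℝ {V, W})
    (h : Metric.infDist I (affineSpan ℝ {V, W} : Set Pt) = dist I T) :
    inner ℝ (I - T) (W - V) = 0 := by
  rcases eq_or_ne W V with rfl | hVW
  · simp
  have hpos : 0 < ‖W - V‖ ^ 2 := pow_pos (norm_pos_iff.2 (sub_ne_zero.2 hVW)) 2
  set c : ℝ := inner ℝ (I - T) (W - V) with hc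
  set s : ℝ := c / ‖W - V‖ ^ 2 with hs
  have hmem : s • (W - V) + T ∈ affineSpan ℝ {V, W} :=
    AffineSubspace.vadd_mem_of_mem_direction
      (Submodule.smul_mem _ s (AffineSubspace.vsub_mem_direction
        (right_mem_affineSpan_pair ℝ V W) (left_mem_affineSpan_pair ℝ V W))) hT
  have hle : dist I T ≤ dist I (s • (W - V) + T) := h ▸ Metric.infDist_le_dist_of_mem hmem
  have hsq : ‖I - T‖ ^ 2 ≤ ‖(I - T) - s • (W - V)‖ ^ 2 := by
    rw [dist_eq_norm, dist_eq_norm] at hle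
    have : I - (s • (W - V) + T) = (I - T) - s • (W - V) := by abel
    rw [this] at hle
    gcongr
  rw [norm_sub_sq_real (I - T), inner_smul_right, norm_smul, mul_pow, Real.norm_eq_abs, sq_abs,
    ← hc] at hsq
  have hcs : c = s * ‖W - V‖ ^ 2 := (div_mul_cancel₀ c hpos.ne').symm
  have hs0 : s = 0 := by
    have : s ^ 2 * ‖W - V‖ ^ 2 ≤ 0 := by rw [hcs] at hsq; nlinarith
    have : s ^ 2 ≤ 0 := by nlinarith
    nlinarith
  rw [hcs, hs0, zero_mul]

/-- Pythagoras for the point obtained by extending the side `WV` beyond `V` by `x`, where the side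
touches the circle with centre `I` and radius `r` at `T`. -/
lemma dist_sq_extension_of_tangent {I T V W : Pt} {r : ℝ} (hT : Sbtw ℝ V T W)
    (hIT : dist I T = r) (h : Metric.infDist I (affineSpan ℝ {V, W} : Set Pt) = r) (x : ℝ) :
    dist I (V + (x / dist V W) • (V - W)) ^ 2 = r ^ 2 + (dist V T + x) ^ 2 := by
  have horth := inner_sub_eq_zero_of_dist_eq_infDist hT.wbtw.mem_affineSpan (h.trans hIT.symm)
  have hL : dist V W ≠ 0 := dist_ne_zero.2 hT.left_ne_right
  obtain ⟨t, ⟨ht0, -⟩, rfl⟩ := hT.wbtw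
  rw [dist_left_lineMap, Real.norm_of_nonneg ht0]
  set T := AffineMap.lineMap V W t with hTdef
  have hTV : T = t • (W - V) + V := by simp [hTdef, AffineMap.lineMap_apply]
  have hdecomp : I - (V + (x / dist V W) • (V - W)) =
      (I - T) + (t + x / dist V W) • (W - V) := by
    rw [hTV]; module
  rw [dist_eq_norm I, hdecomp, norm_add_sq_real, inner_smul_right, horth, norm_smul, mul_pow,
    Real.norm_eq_abs, sq_abs, ← dist_eq_norm I, hIT, ← dist_eq_norm W V, dist_comm W V]
  field_simp
  ring

/-- A function on `ZMod n`, `n` odd, which is invariant under translation by `2` is constant. -/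
lemma ZMod.eq_of_forall_add_two_eq {α : Type*} {n : ℕ} (hn : Odd n) {c : ZMod n → α}
    (hc : ∀ i, c (i + 2) = c i) (i : ZMod n) : c i = c 0 := by
  obtain ⟨k, rfl⟩ := hn
  have hmul : ∀ (m : ℕ) (j : ZMod (2 * k + 1)), c (j + 2 * m) = c j := by
    intro m j
    induction m with
    | zero => simp
    | succ m ih =>
      rw [← ih, ← hc (j + 2 * m)]
      congr 1
      push_cast
      ring
  have hcast : (2 * (k : ZMod (2 * k + 1)) + 1) = 0 := by
    exact_mod_cast ZMod.natCast_self (2 * k + 1)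
  have hi : i = 0 + 2 * (((k + 1) * i.val : ℕ) : ZMod (2 * k + 1)) := by
    push_cast
    rw [ZMod.natCast_zmod_val]
    linear_combination -i * hcast
  rw [hi, hmul]

/-- **Theorem 2 (sufficiency): Conway circles for odd tangential polygons.**
For an odd convex tangential polygon with vertices `V i` (`i : ZMod n`),
incenter `I` and inradius `r`, if the extension lengths `x i` satisfy
`x i - x (i+2) = λ (i+1) - λ i` for all `i`, then the `2n` extension endpoints
are equidistant from `I`. -/
theorem conway_circles_odd_polygon_sufficiency
    (n : ℕ) (hn : 3 ≤ n) (hnodd : Odd n)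
    (V : ZMod n → Pt) (I : Pt) (r : ℝ) (hr : 0 < r)
    (hne : ∀ i : ZMod n, V i ≠ V (i + 1))
    (htangent : ∀ i : ZMod n, ∃ T : Pt, Sbtw ℝ (V i) T (V (i + 1)) ∧ dist I T = r ∧
      Metric.infDist I (affineSpan ℝ {V i, V (i + 1)} : Set Pt) = r)
    (hconvex : ∀ i j : ZMod n, j ≠ i → j ≠ i + 1 →
      (affineSpan ℝ {V i, V (i + 1)}).SSameSide I (V j))
    (lam : ZMod n → ℝ) (hlam : ∀ i : ZMod n, lam i = dist (V i) (V (i + 1)))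
    (x : ZMod n → ℝ)
    (hx : ∀ i : ZMod n, x i - x (i + 2) = lam (i + 1) - lam i) :
    ∃ ρ : ℝ, ∀ i : ZMod n,
      dist I (V i + (x i / lam i) • (V i - V (i + 1))) = ρ ∧
      dist I (V i + (x i / lam (i - 1)) • (V i - V (i - 1))) = ρ := by
  choose T hT hIT hinf using htangent
  have hfwd (i : ZMod n) (y : ℝ) : dist I (V i + (y / lam i) • (V i - V (i + 1))) ^ 2 =
      r ^ 2 + (dist (V i) (T i) + y) ^ 2 := by
    rw [hlam]
    exact dist_sq_extension_of_tangent (hT i) (hIT i) (hinf i) y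
  have hbwd (i : ZMod n) (y : ℝ) : dist I (V (i + 1) + (y / lam i) • (V (i + 1) - V i)) ^ 2 =
      r ^ 2 + (dist (V (i + 1)) (T i) + y) ^ 2 := by
    rw [hlam, dist_comm (V i)]
    exact dist_sq_extension_of_tangent (hT i).symm (hIT i)
      (by rw [Set.pair_comm]; exact hinf i) y
  have htan (i : ZMod n) : dist (V (i + 1)) (T i) = dist (V (i + 1)) (T (i + 1)) := by
    have h₁ := hbwd i 0
    have h₂ := hfwd (i + 1) 0
    simp only [zero_div, zero_smul, add_zero] at h₁ h₂
    exact (sq_eq_sq₀ dist_nonneg dist_nonneg).1 (by linarith)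
  have hside (i : ZMod n) :
      lam i = dist (V i) (T i) + dist (V (i + 1)) (T (i + 1)) := by
    rw [hlam, ← htan, dist_comm (V (i + 1)), (hT i).wbtw.dist_add_dist]
  have hconst := ZMod.eq_of_forall_add_two_eq hnodd (c := fun i => dist (V i) (T i) + x i)
    (fun i => by
      have h₁ := hside i
      have h₂ := hside (i + 1)
      have h₃ := hx i
      rw [add_assoc, one_add_one_eq_two] at h₂
      linarith)
  refine ⟨√(r ^ 2 + (dist (V 0) (T 0) + x 0) ^ 2), fun i => ⟨?_, ?_⟩⟩
  · rw [← hconst i, ← hfwd, Real.sqrt_sq dist_nonneg]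
  · obtain ⟨j, rfl⟩ : ∃ j, i = j + 1 := ⟨i - 1, by ring⟩
    rw [← hconst (j + 1), ← htan, ← hbwd, Real.sqrt_sq dist_nonneg, add_sub_cancel_right]
end
end

section
/- (Theorem 2, necessity: Conway circles for odd tangential polygons.) Let n ≥ 3 be odd and let V : ZMod n → ℝ² be the vertices of a convex tangential polygon with incenter I, inradius r > 0, and side lengths λ i = dist (V i) (V (i+1)). Let x : ZMod n → ℝ with x i ≥ 0 for all i, and for each i form the two points obtained by extending both sides through V i beyond V i by length x i: the point V i + (x i / λ i) • (V i - V (i+1)) and the point V i + (x i / λ (i-1)) • (V i - V (i-1)). If all 2n resulting points are equidistant from I (i.e., lie on a common circle centered at I), then x i - x (i+2) = λ (i+1) - λ i for every i. -/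
noncomputable section

/-- If the foot `T` realizes the distance from `I` to the line `AB`, then `I - T` is orthogonal
to `AB`. -/
theorem inner_eq_zero_of_dist_eq_infDist {I A B T : Pt}
    (hT : T ∈ affineSpan ℝ {A, B})
    (h : dist I T = Metric.infDist I (affineSpan ℝ {A, B} : Set Pt)) :
    inner ℝ (I - T) (B - A) = 0 := by
  have hd : B - A ∈ (affineSpan ℝ {A, B}).direction :=
    AffineSubspace.vsub_mem_direction (right_mem_affineSpan_pair ℝ A B)
      (left_mem_affineSpan_pair ℝ A B)
  have key (s : ℝ) : 0 ≤ ‖B - A‖ ^ 2 * (s * s) + -2 * inner ℝ (I - T) (B - A) * s + 0 := by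
    have hmem : s • (B - A) + T ∈ affineSpan ℝ {A, B} :=
      AffineSubspace.vadd_mem_of_mem_direction (Submodule.smul_mem _ s hd) hT
    have hle := h.trans_le (Metric.infDist_le_dist_of_mem (x := I) hmem)
    rw [dist_eq_norm, dist_eq_norm, sub_add_eq_sub_sub_swap] at hle
    have hsq := pow_le_pow_left₀ (norm_nonneg _) hle 2
    rw [norm_sub_sq_real (I - T), inner_smul_right, norm_smul, mul_pow, Real.norm_eq_abs,
      sq_abs] at hsq
    linarith
  have hdiscrim := discrim_le_zero key
  rw [discrim] at hdiscrim
  nlinarith [sq_nonneg (inner ℝ (I - T) (B - A))]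

/-- A circle of center `I` and radius `r` touching the segment `AB` at an interior point splits it
into two tangent lengths, which determine the distance from `I` to the extensions beyond `A`. -/
theorem exists_tangent_lengths {I A B T : Pt} {r : ℝ} (hT : Sbtw ℝ A T B) (hr : dist I T = r)
    (hdist : Metric.infDist I (affineSpan ℝ {A, B} : Set Pt) = r) :
    ∃ a b : ℝ, 0 < a ∧ 0 < b ∧ a + b = dist A B ∧
      dist I A ^ 2 = r ^ 2 + a ^ 2 ∧ dist I B ^ 2 = r ^ 2 + b ^ 2 ∧
      ∀ x : ℝ, dist I (A + (x / dist A B) • (A - B)) ^ 2 = r ^ 2 + (a + x) ^ 2 := by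
  have horth := inner_eq_zero_of_dist_eq_infDist hT.wbtw.mem_affineSpan (hr.trans hdist.symm)
  have hAB : 0 < dist A B := dist_pos.2 hT.left_ne_right
  obtain ⟨t, ⟨ht0, ht1⟩, rfl⟩ := (sbtw_iff_mem_image_Ioo_and_ne.1 hT).1
  set T := AffineMap.lineMap A B t with hTdef
  have hTA : T = t • (B - A) + A := by simp [hTdef, AffineMap.lineMap_apply]
  have pythagoras (s : ℝ) : dist I (T + s • (B - A)) ^ 2 = r ^ 2 + (s * dist A B) ^ 2 := by
    rw [dist_eq_norm, sub_add_eq_sub_sub, norm_sub_sq_real, inner_smul_right, horth, norm_smul,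
      mul_pow, Real.norm_eq_abs, sq_abs, ← dist_eq_norm, hr, ← dist_eq_norm, dist_comm B A]
    ring
  refine ⟨t * dist A B, (1 - t) * dist A B, by positivity, mul_pos (by linarith) hAB, by ring,
    ?_, ?_, fun x => ?_⟩
  · have h := pythagoras (-t)
    have hA : T + (-t) • (B - A) = A := by rw [hTA]; module
    rw [hA] at h
    linarith
  · have h := pythagoras (1 - t)
    have hB : T + (1 - t) • (B - A) = B := by rw [hTA]; module
    rwa [hB] at h
  · have h := pythagoras (-(t + x / dist A B))
    have hP : T + (-(t + x / dist A B)) • (B - A) = A + (x / dist A B) • (A - B) := by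
      rw [hTA]; module
    rw [hP] at h
    rw [h]
    field_simp

/-- **Theorem 2 (necessity): Conway circles for odd tangential polygons.**
For an odd convex tangential polygon with vertices `V i` (`i : ZMod n`),
incenter `I` and inradius `r`, if the `2n` endpoints of nonnegative extensions
`x i` are equidistant from `I`, then `x i - x (i+2) = λ (i+1) - λ i` for all
`i`. -/
theorem conway_circles_odd_polygon_necessity
    (n : ℕ) (hn : 3 ≤ n) (hnodd : Odd n)
    (V : ZMod n → Pt) (I : Pt) (r : ℝ) (hr : 0 < r)
    (hne : ∀ i : ZMod n, V i ≠ V (i + 1))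
    (htangent : ∀ i : ZMod n, ∃ T : Pt, Sbtw ℝ (V i) T (V (i + 1)) ∧ dist I T = r ∧
      Metric.infDist I (affineSpan ℝ {V i, V (i + 1)} : Set Pt) = r)
    (hconvex : ∀ i j : ZMod n, j ≠ i → j ≠ i + 1 →
      (affineSpan ℝ {V i, V (i + 1)}).SSameSide I (V j))
    (lam : ZMod n → ℝ) (hlam : ∀ i : ZMod n, lam i = dist (V i) (V (i + 1)))
    (x : ZMod n → ℝ) (hx0 : ∀ i : ZMod n, 0 ≤ x i)
    (hconcyclic : ∃ ρ : ℝ, ∀ i : ZMod n,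
      dist I (V i + (x i / lam i) • (V i - V (i + 1))) = ρ ∧
      dist I (V i + (x i / lam (i - 1)) • (V i - V (i - 1))) = ρ) :
    ∀ i : ZMod n, x i - x (i + 2) = lam (i + 1) - lam i := by
  choose T hT hIT hinf using htangent
  choose a b ha hb hab hIA hIB hext using
    fun i => exists_tangent_lengths (hT i) (hIT i) (hinf i)
  obtain ⟨ρ, hρ⟩ := hconcyclic
  have hba (i : ZMod n) : b i = a (i + 1) := by
    refine (pow_left_inj₀ (hb i).le (ha (i + 1)).le two_ne_zero).1 ?_
    linarith [hIB i, hIA (i + 1)]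
  have hconst (i j : ZMod n) : a i + x i = a j + x j := by
    refine (pow_left_inj₀ (add_nonneg (ha i).le (hx0 i)) (add_nonneg (ha j).le (hx0 j))
      two_ne_zero).1 ?_
    have hi := hext i (x i)
    have hj := hext j (x j)
    rw [← hlam, (hρ _).1] at hi hj
    linarith
  intro i
  have h1 := hab i
  have h2 := hab (i + 1)
  rw [hba, ← hlam] at h1 h2
  rw [add_assoc, one_add_one_eq_two] at h2
  linarith [hconst i (i + 2)]
end
end

section
/- (Corollary 3: Conway's circle for tangential pentagons.) Let A, B, C, D, E be the vertices (in cyclic order) of a convex tangential pentagon with incenter I and inradius r > 0, and set a = dist C D, b = dist D E, c = dist E A, d = dist A B, e = dist B C (so each letter is the length of the side opposite the corresponding vertex). Extend both sides through A beyond A by length b + e, both sides through B beyond B by a + c, both sides through C beyond C by b + d, both sides through D beyond D by c + e, and both sides through E beyond E by a + d (so, e.g., at A one forms A + ((b+e)/d) • (A - B) and A + ((b+e)/c) • (A - E)). Then the resulting 10 points are all equidistant from I, i.e., they lie on a common circle centered at the pentagon's incenter. -/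
noncomputable section

/-- A side `PQ` of a polygon is tangent to the circle of center `I`, radius `r`,
at a point strictly between `P` and `Q`. -/
def TangentSide (I : Pt) (r : ℝ) (P Q : Pt) : Prop :=
  (∃ T : Pt, Sbtw ℝ P T Q ∧ dist I T = r) ∧
    Metric.infDist I (affineSpan ℝ {P, Q} : Set Pt) = r

/-- The length of the tangent from `P` to the circle of center `I` and radius `r`. -/
def tangentLength (I : Pt) (r : ℝ) (P : Pt) : ℝ :=
  √(dist I P ^ 2 - r ^ 2)

theorem TangentSide.symm {I : Pt} {r : ℝ} {P Q : Pt} (h : TangentSide I r P Q) :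
    TangentSide I r Q P := by
  obtain ⟨⟨T, hT, hIT⟩, hd⟩ := h
  exact ⟨⟨T, hT.symm, hIT⟩, by rwa [Set.pair_comm]⟩

/-- If `w` is a shortest vector of the form `w - s • v`, then `w` is orthogonal to `v`. -/
theorem inner_eq_zero_of_forall_norm_le_norm_sub_smul {V : Type*} [NormedAddCommGroup V]
    [InnerProductSpace ℝ V] {w v : V} (h : ∀ s : ℝ, ‖w‖ ≤ ‖w - s • v‖) :
    inner ℝ w v = 0 := by
  rcases eq_or_ne v 0 with rfl | hv
  · simp
  have hv' : 0 < ‖v‖ ^ 2 := by positivity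
  have hsq := pow_le_pow_left₀ (norm_nonneg w) (h (inner ℝ w v / ‖v‖ ^ 2)) 2
  rw [norm_sub_sq_real, inner_smul_right, norm_smul, mul_pow, Real.norm_eq_abs, sq_abs] at hsq
  have hle : inner ℝ w v ^ 2 / ‖v‖ ^ 2 ≤ 0 := by
    have key : (inner ℝ w v / ‖v‖ ^ 2) ^ 2 * ‖v‖ ^ 2 = inner ℝ w v ^ 2 / ‖v‖ ^ 2 := by
      field_simp
    have key' : inner ℝ w v / ‖v‖ ^ 2 * inner ℝ w v = inner ℝ w v ^ 2 / ‖v‖ ^ 2 := by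
      ring
    linarith
  rw [div_le_iff₀ hv', zero_mul] at hle
  exact pow_eq_zero_iff two_ne_zero |>.mp (le_antisymm hle (sq_nonneg _))

/-- A tangent side splits at its point of tangency `P + τ • (Q - P)`, and distances from `I` to
points of its line are given by the Pythagorean theorem. -/
theorem TangentSide.exists_dist_sq_eq {I : Pt} {r : ℝ} {P Q : Pt} (h : TangentSide I r P Q) :
    ∃ τ : ℝ, 0 < τ ∧ τ < 1 ∧ ∀ s : ℝ,
      dist I (P + s • (Q - P)) ^ 2 = r ^ 2 + ((τ - s) * dist P Q) ^ 2 := by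
  obtain ⟨⟨T, hT, hIT⟩, hd⟩ := h
  obtain ⟨-, τ, ⟨hτ₀, hτ₁⟩, rfl⟩ := sbtw_iff_mem_image_Ioo_and_ne.mp hT |>.symm
  refine ⟨τ, hτ₀, hτ₁, fun s => ?_⟩
  set T := AffineMap.lineMap P Q τ with hTdef
  have hTeq : T = P + τ • (Q - P) := by
    rw [hTdef, AffineMap.lineMap_apply, vsub_eq_sub, vadd_eq_add, add_comm]
  have horth : inner ℝ (I - T) (Q - P) = 0 := by
    refine inner_eq_zero_of_forall_norm_le_norm_sub_smul fun s => ?_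
    have hmem : AffineMap.lineMap P Q (τ + s) ∈ (affineSpan ℝ {P, Q} : Set Pt) :=
      AffineMap.lineMap_mem_affineSpan_pair _ _ _
    have hle := Metric.infDist_le_dist_of_mem (x := I) hmem
    rw [hd, ← hIT, dist_eq_norm, dist_eq_norm] at hle
    have hsub : I - T - s • (Q - P) = I - AffineMap.lineMap P Q (τ + s) := by
      rw [hTeq, AffineMap.lineMap_apply, vsub_eq_sub, vadd_eq_add]
      module
    rwa [hsub]
  have hsub : I - (P + s • (Q - P)) = (I - T) + (τ - s) • (Q - P) := by
    rw [hTeq]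
    module
  rw [dist_eq_norm, hsub, norm_add_sq_real, inner_smul_right, horth, ← dist_eq_norm, hIT,
    norm_smul, ← dist_eq_norm Q P, dist_comm Q P, Real.norm_eq_abs, mul_pow, sq_abs]
  ring

theorem TangentSide.dist_eq_add {I : Pt} {r : ℝ} {P Q : Pt} (h : TangentSide I r P Q) :
    dist P Q = tangentLength I r P + tangentLength I r Q := by
  obtain ⟨τ, hτ₀, hτ₁, hdist⟩ := h.exists_dist_sq_eq
  have hP := hdist 0
  have hQ := hdist 1
  rw [zero_smul, add_zero] at hP
  rw [one_smul, add_sub_cancel] at hQ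
  rw [tangentLength, tangentLength, hP, hQ, add_sub_cancel_left, add_sub_cancel_left,
    Real.sqrt_sq_eq_abs, Real.sqrt_sq_eq_abs, abs_mul, abs_mul, abs_dist, sub_zero,
    abs_of_pos hτ₀, abs_of_neg (sub_neg.mpr hτ₁)]
  ring

/-- Extending a tangent side `QP` beyond `P` by `x` gives a point whose tangent length is that
of `P` plus `x`. -/
theorem TangentSide.dist_extend {I : Pt} {r : ℝ} {P Q : Pt} (h : TangentSide I r P Q)
    (hPQ : P ≠ Q) (x : ℝ) :
    dist I (P + (x / dist P Q) • (P - Q)) = √(r ^ 2 + (tangentLength I r P + x) ^ 2) := by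
  obtain ⟨τ, hτ₀, -, hdist⟩ := h.exists_dist_sq_eq
  have hL : dist P Q ≠ 0 := dist_ne_zero.mpr hPQ
  have hP := hdist 0
  rw [zero_smul, add_zero, sub_zero] at hP
  have ht : tangentLength I r P = τ * dist P Q := by
    rw [tangentLength, hP, add_sub_cancel_left, Real.sqrt_sq (by positivity)]
  have hx := hdist (-(x / dist P Q))
  rw [show (-(x / dist P Q)) • (Q - P) = (x / dist P Q) • (P - Q) by module,
    show (τ - -(x / dist P Q)) * dist P Q = τ * dist P Q + x by field_simp; ring] at hx
  rw [ht, ← hx, Real.sqrt_sq dist_nonneg]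

/-- **Corollary 3: Conway's circle for tangential pentagons.**
For a convex tangential pentagon `ABCDE` with opposite side lengths
`a, b, c, d, e`, extending the sides through `A, B, C, D, E` by
`b + e, a + c, b + d, c + e, a + d` respectively yields `10` points equidistant
from the incenter `I`. -/
theorem conway_circle_pentagon
    (A B C D E I : Pt) (r : ℝ) (hr : 0 < r)
    (hAB : A ≠ B) (hBC : B ≠ C) (hCD : C ≠ D) (hDE : D ≠ E) (hEA : E ≠ A)
    (htAB : TangentSide I r A B) (htBC : TangentSide I r B C)
    (htCD : TangentSide I r C D) (htDE : TangentSide I r D E)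
    (htEA : TangentSide I r E A)
    (hcAB : (affineSpan ℝ {A, B}).SSameSide I C ∧
      (affineSpan ℝ {A, B}).SSameSide I D ∧ (affineSpan ℝ {A, B}).SSameSide I E)
    (hcBC : (affineSpan ℝ {B, C}).SSameSide I D ∧
      (affineSpan ℝ {B, C}).SSameSide I E ∧ (affineSpan ℝ {B, C}).SSameSide I A)
    (hcCD : (affineSpan ℝ {C, D}).SSameSide I E ∧
      (affineSpan ℝ {C, D}).SSameSide I A ∧ (affineSpan ℝ {C, D}).SSameSide I B)
    (hcDE : (affineSpan ℝ {D, E}).SSameSide I A ∧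
      (affineSpan ℝ {D, E}).SSameSide I B ∧ (affineSpan ℝ {D, E}).SSameSide I C)
    (hcEA : (affineSpan ℝ {E, A}).SSameSide I B ∧
      (affineSpan ℝ {E, A}).SSameSide I C ∧ (affineSpan ℝ {E, A}).SSameSide I D)
    (a b c d e : ℝ)
    (ha : a = dist C D) (hb : b = dist D E) (hc : c = dist E A)
    (hd : d = dist A B) (he : e = dist B C) :
    ∃ ρ : ℝ,
      dist I (A + ((b + e) / d) • (A - B)) = ρ ∧
      dist I (A + ((b + e) / c) • (A - E)) = ρ ∧
      dist I (B + ((a + c) / d) • (B - A)) = ρ ∧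
      dist I (B + ((a + c) / e) • (B - C)) = ρ ∧
      dist I (C + ((b + d) / e) • (C - B)) = ρ ∧
      dist I (C + ((b + d) / a) • (C - D)) = ρ ∧
      dist I (D + ((c + e) / a) • (D - C)) = ρ ∧
      dist I (D + ((c + e) / b) • (D - E)) = ρ ∧
      dist I (E + ((a + d) / b) • (E - D)) = ρ ∧
      dist I (E + ((a + d) / c) • (E - A)) = ρ := by
  subst ha hb hc hd he
  refine ⟨√(r ^ 2 + (tangentLength I r A + tangentLength I r B + tangentLength I r C +
    tangentLength I r D + tangentLength I r E) ^ 2), ?_, ?_, ?_, ?_, ?_, ?_, ?_, ?_, ?_, ?_⟩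
  · rw [htAB.dist_extend hAB, htDE.dist_eq_add, htBC.dist_eq_add]
    ring_nf
  · rw [dist_comm E A, htEA.symm.dist_extend hEA.symm,
      htDE.dist_eq_add, htBC.dist_eq_add]
    ring_nf
  · rw [dist_comm A B, htAB.symm.dist_extend hAB.symm,
      htCD.dist_eq_add, htEA.dist_eq_add]
    ring_nf
  · rw [htBC.dist_extend hBC, htCD.dist_eq_add, htEA.dist_eq_add]
    ring_nf
  · rw [dist_comm B C, htBC.symm.dist_extend hBC.symm,
      htDE.dist_eq_add, htAB.dist_eq_add]
    ring_nf
  · rw [htCD.dist_extend hCD, htDE.dist_eq_add, htAB.dist_eq_add]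
    ring_nf
  · rw [dist_comm C D, htCD.symm.dist_extend hCD.symm,
      htEA.dist_eq_add, htBC.dist_eq_add]
    ring_nf
  · rw [htDE.dist_extend hDE, htEA.dist_eq_add, htBC.dist_eq_add]
    ring_nf
  · rw [dist_comm D E, htDE.symm.dist_extend hDE.symm,
      htCD.dist_eq_add, htAB.dist_eq_add]
    ring_nf
  · rw [htEA.dist_extend hEA, htCD.dist_eq_add, htAB.dist_eq_add]
    ring_nf
end
end
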